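/- For positive semidefinite M ≤ I on H_A ⊗ H_B and 0 < p < 1, the quantity h_p(M) := max_{τ state on H_B} ‖M^{p/2} (I_A ⊗ τ)^p M^{p/2}‖ equals max over unit vectors φ of ‖Tr_A[M^{p/2} |φ⟩⟨φ| M^{p/2}]‖_q with q = 1/(1-p), where ‖·‖ is the operator norm and ‖·‖_q the Schatten q-norm. -/

import Mathlib

open scoped Kronecker ComplexOrder

noncomputable section

variable {α β : Type*} [Fintype α] [DecidableEq α] [Fintype β] [DecidableEq β]

/-- A density operator: positive semidefinite with unit trace. -/
def IsState (ρ : Matrix α α ℂ) : Prop := ρ.PosSemidef ∧ ρ.trace = 1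

/-- A unit vector. -/
def UnitVector (ψ : α → ℂ) : Prop := ∑ i, Complex.normSq (ψ i) = 1

/-- Rank-one projector |ψ⟩⟨ψ|. -/
def proj (ψ : α → ℂ) : Matrix α α ℂ := Matrix.vecMulVec ψ (star ψ)

/-- Eigenvalues of a Hermitian matrix (junk value 0 otherwise). -/
def eigs (M : Matrix α α ℂ) : α → ℝ := if h : M.IsHermitian then h.eigenvalues else 0

/-- Von Neumann entropy S(ρ) = -Tr ρ log ρ (with 0 log 0 = 0). -/
def vnEntropy (ρ : Matrix α α ℂ) : ℝ := -∑ i, eigs ρ i * Real.log (eigs ρ i)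

/-- Functional calculus for Hermitian matrices (junk value 0 otherwise). -/
def mfun (g : ℝ → ℝ) (M : Matrix α α ℂ) : Matrix α α ℂ :=
  if h : M.IsHermitian then
    (h.eigenvectorUnitary : Matrix α α ℂ) * Matrix.diagonal (fun i => (g (h.eigenvalues i) : ℂ)) *
      star (h.eigenvectorUnitary : Matrix α α ℂ)
  else 0

/-- Matrix logarithm (spectral, with the convention log 0 = 0). -/
def mlog : Matrix α α ℂ → Matrix α α ℂ := mfun Real.log

/-- Matrix exponential (spectral). -/
def mexp : Matrix α α ℂ → Matrix α α ℂ := mfun Real.exp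

/-- Matrix real power (spectral). -/
def mpow (p : ℝ) : Matrix α α ℂ → Matrix α α ℂ := mfun (fun x => x ^ p)

/-- Maximal eigenvalue of a Hermitian matrix. -/
def lmax (M : Matrix α α ℂ) : ℝ := ⨆ i, eigs M i

/-- Schatten q-norm of a positive semidefinite matrix. -/
def schatten (q : ℝ) (M : Matrix α α ℂ) : ℝ := (∑ i, eigs M i ^ q) ^ (1/q)

/-- Partial trace over the first tensor factor. -/
def trA (ρ : Matrix (α × β) (α × β) ℂ) : Matrix β β ℂ := fun i j => ∑ k, ρ (k, i) (k, j)

/-- Partial trace over the second tensor factor. -/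
def trB (ρ : Matrix (α × β) (α × β) ℂ) : Matrix α α ℂ := fun i j => ∑ k, ρ (i, k) (j, k)

/-- The conjugate (Legendre-type transform) f*(X) = sup over states ρ of (Tr[ρX] - f ρ). -/
def conjF (f : Matrix α α ℂ → ℝ) (X : Matrix α α ℂ) : ℝ :=
  sSup {x | ∃ ρ, IsState ρ ∧ x = (ρ * X).trace.re - f ρ}

/-- The biconjugate / convex closure f̂(ρ) = sup over Hermitian X of (Tr[ρX] - f*(X)). -/
def cclF (f : Matrix α α ℂ → ℝ) (ρ : Matrix α α ℂ) : ℝ :=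
  sSup {x | ∃ X : Matrix α α ℂ, X.IsHermitian ∧ x = (ρ * X).trace.re - conjF f X}

/-- Boundedness of a function on the state space. -/
def BoundedOnStates (f : Matrix α α ℂ → ℝ) : Prop := ∃ C, ∀ ρ, IsState ρ → |f ρ| ≤ C

/-- Values of finite convex combinations Σ pᵢ f(ρᵢ) over ensembles realizing ρ. -/
def ensembleValues (f : Matrix α α ℂ → ℝ) (ρ : Matrix α α ℂ) : Set ℝ :=
  {x | ∃ (N : ℕ) (p : Fin N → ℝ) (σ : Fin N → Matrix α α ℂ),
      (∀ i, 0 ≤ p i) ∧ ∑ i, p i = 1 ∧ (∀ i, IsState (σ i)) ∧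
      ∑ i, p i • σ i = ρ ∧ x = ∑ i, p i * f (σ i)}

/-- Entanglement of formation of a bipartite state on H_A ⊗ H_B. -/
def EoF (ρ : Matrix (α × β) (α × β) ℂ) : ℝ :=
  sInf {x | ∃ (N : ℕ) (p : Fin N → ℝ) (ψ : Fin N → (α × β → ℂ)),
      (∀ i, 0 ≤ p i) ∧ ∑ i, p i = 1 ∧ (∀ i, UnitVector (ψ i)) ∧
      ∑ i, p i • proj (ψ i) = ρ ∧ x = ∑ i, p i * vnEntropy (trB (proj (ψ i)))}

/-- g(M) = max over unit ψ of (Tr[Ψ log M] - S(Tr_A Ψ)). -/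
def gFun (M : Matrix (α × β) (α × β) ℂ) : ℝ :=
  sSup {x | ∃ ψ : α × β → ℂ, UnitVector ψ ∧
      x = (proj ψ * mlog M).trace.re - vnEntropy (trA (proj ψ))}

end

section

variable {α β : Type*} [Fintype α]

lemma trace_one_kronecker_mul [DecidableEq α] [Fintype β] (T : Matrix β β ℂ) (R : Matrix (α × β) (α × β) ℂ) :
    (((1 : Matrix α α ℂ) ⊗ₖ T) * R).trace = (T * trA R).trace := by
  have hT : (T * trA R).trace = ∑ i, ∑ j, ∑ k, T i j * R (k, j) (k, i) := by
    simp only [Matrix.trace, Matrix.diag, Matrix.mul_apply, ← Finset.mul_sum]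
    rfl
  have hL : (((1 : Matrix α α ℂ) ⊗ₖ T) * R).trace = ∑ k, ∑ i, ∑ j, T i j * R (k, j) (k, i) := by
    simp only [Matrix.trace, Matrix.diag, Matrix.mul_apply, Matrix.kroneckerMap_apply,
      Fintype.sum_prod_type]
    refine Finset.sum_congr rfl fun k _ => Finset.sum_congr rfl fun i _ => ?_
    rw [Finset.sum_eq_single k] <;> simp +contextual [eq_comm]
  rw [hT, hL, Finset.sum_comm]
  exact Finset.sum_congr rfl fun i _ => Finset.sum_comm

lemma posSemidef_trA {R : Matrix (α × β) (α × β) ℂ} (h : R.PosSemidef) : (trA R).PosSemidef := by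
  have : trA R = ∑ k, R.submatrix (fun i => (k, i)) (fun i => (k, i)) := by
    ext i j
    simp [trA, Matrix.sum_apply]
  rw [this]
  exact Matrix.posSemidef_sum _ fun k _ => h.submatrix _

lemma posSemidef_proj (φ : α → ℂ) : (proj φ).PosSemidef :=
  Matrix.posSemidef_vecMulVec_self_star φ

lemma trace_proj {φ : α → ℂ} (h : UnitVector φ) : (proj φ).trace = 1 := by
  have h' : ∑ i, Complex.normSq (φ i) = 1 := h
  simp only [proj, Matrix.trace, Matrix.diag, Matrix.vecMulVec_apply, Pi.star_apply,
    RCLike.star_def, Complex.mul_conj]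
  exact_mod_cast h'

lemma isState_proj {φ : α → ℂ} (h : UnitVector φ) : IsState (proj φ) :=
  ⟨posSemidef_proj φ, trace_proj h⟩

/-- Hölder's inequality for a doubly stochastic coupling of two families. -/
lemma sum_rpow_mul_le_of_stochastic {p : ℝ} (hp : 0 < p) (hp1 : p < 1) {t s : α → ℝ}
    (ht : ∀ i, 0 ≤ t i) (hs : ∀ i, 0 ≤ s i) {w : α → α → ℝ} (hw : ∀ i j, 0 ≤ w i j)
    (hrow : ∀ i, ∑ j, w i j = 1) (hcol : ∀ j, ∑ i, w i j = 1) :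
    ∑ i, ∑ j, t i ^ p * s j * w i j ≤
      (∑ i, t i) ^ p * (∑ j, s j ^ (1 / (1 - p))) ^ (1 - p) := by
  have h1p : 0 < 1 - p := by linarith
  have hpq : (1 / p).HolderConjugate (1 / (1 - p)) := by
    rw [Real.holderConjugate_iff]
    refine ⟨by rw [lt_div_iff₀ hp]; linarith, ?_⟩
    simp
  have key := Real.inner_le_Lp_mul_Lq_of_nonneg (Finset.univ : Finset (α × α))
    (f := fun x => t x.1 ^ p * w x.1 x.2 ^ p) (g := fun x => s x.2 * w x.1 x.2 ^ (1 - p)) hpq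
    (fun x _ => mul_nonneg (Real.rpow_nonneg (ht _) _) (Real.rpow_nonneg (hw _ _) _))
    (fun x _ => mul_nonneg (hs _) (Real.rpow_nonneg (hw _ _) _))
  have e1 : ∀ i j, (t i ^ p * w i j ^ p) * (s j * w i j ^ (1 - p)) = t i ^ p * s j * w i j := by
    intro i j
    have : w i j ^ p * w i j ^ (1 - p) = w i j := by
      rw [← Real.rpow_add_of_nonneg (hw i j) hp.le h1p.le, add_sub_cancel, Real.rpow_one]
    calc _ = t i ^ p * s j * (w i j ^ p * w i j ^ (1 - p)) := by ring
      _ = _ := by rw [this]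
  have e2 : ∀ i j, (t i ^ p * w i j ^ p) ^ (1 / p) = t i * w i j := by
    intro i j
    rw [← Real.mul_rpow (ht i) (hw i j), ← Real.rpow_mul (mul_nonneg (ht i) (hw i j)),
      mul_one_div_cancel hp.ne', Real.rpow_one]
  have e3 : ∀ i j, (s j * w i j ^ (1 - p)) ^ (1 / (1 - p)) = s j ^ (1 / (1 - p)) * w i j := by
    intro i j
    rw [Real.mul_rpow (hs j) (Real.rpow_nonneg (hw i j) _), ← Real.rpow_mul (hw i j),
      mul_one_div_cancel h1p.ne', Real.rpow_one]
  simp only [Fintype.sum_prod_type, e1, e2, e3, one_div_one_div] at key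
  rw [Finset.sum_comm (f := fun i j => s j ^ (1 / (1 - p)) * w i j)] at key
  simpa only [← Finset.mul_sum, hrow, hcol, mul_one] using key

end

section

variable {α β : Type*} [Fintype α] [DecidableEq α] [Fintype β] [DecidableEq β]

lemma continuousOn_spectrum_matrix (g : ℝ → ℝ) (M : Matrix α α ℂ) :
    ContinuousOn g (spectrum ℝ M) :=
  Matrix.finite_real_spectrum.continuousOn g

lemma mfun_eq_cfc (g : ℝ → ℝ) {M : Matrix α α ℂ} (h : M.IsHermitian) : mfun g M = cfc g M := by
  rw [h.cfc_eq, mfun, dif_pos h, Matrix.IsHermitian.cfc, Unitary.conjStarAlgAut_apply]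
  rfl

lemma isHermitian_mfun (g : ℝ → ℝ) {M : Matrix α α ℂ} (h : M.IsHermitian) :
    (mfun g M).IsHermitian := by
  rw [mfun_eq_cfc g h]
  exact cfc_predicate g M

lemma trace_mfun (g : ℝ → ℝ) {M : Matrix α α ℂ} (h : M.IsHermitian) :
    (mfun g M).trace = ((∑ i, g (eigs M i) : ℝ) : ℂ) := by
  rw [mfun, dif_pos h, Matrix.trace_mul_comm, ← mul_assoc]
  simp [eigs, h, Matrix.trace_diagonal]

lemma eigs_nonneg {M : Matrix α α ℂ} (h : M.PosSemidef) (i : α) : 0 ≤ eigs M i := by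
  rw [eigs, dif_pos h.isHermitian]
  exact h.eigenvalues_nonneg i

lemma eigs_mem_spectrum {M : Matrix α α ℂ} (h : M.IsHermitian) (i : α) :
    eigs M i ∈ spectrum ℝ M := by
  rw [eigs, dif_pos h]
  exact h.eigenvalues_mem_spectrum_real i

lemma nonneg_of_mem_spectrum {M : Matrix α α ℂ} (h : M.PosSemidef) {x : ℝ}
    (hx : x ∈ spectrum ℝ M) : 0 ≤ x := by
  rw [h.isHermitian.spectrum_real_eq_range_eigenvalues] at hx
  obtain ⟨i, rfl⟩ := hx
  exact h.eigenvalues_nonneg i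

lemma sum_eigs_eq_one {ρ : Matrix α α ℂ} (h : IsState ρ) : ∑ i, eigs ρ i = 1 := by
  have := h.2.symm.trans h.1.isHermitian.trace_eq_sum_eigenvalues
  simp only [eigs, dif_pos h.1.isHermitian]
  exact Complex.ofReal_injective (by simpa using this.symm)

/-- The star algebra homomorphism `A ↦ 1 ⊗ A`. -/
def oneKronecker (α β : Type*) [Fintype α] [DecidableEq α] [Fintype β] [DecidableEq β] :
    Matrix β β ℂ →⋆ₐ[ℂ] Matrix (α × β) (α × β) ℂ where
  toFun A := (1 : Matrix α α ℂ) ⊗ₖ A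
  map_one' := Matrix.one_kronecker_one
  map_mul' A B := by rw [← Matrix.mul_kronecker_mul, one_mul]
  map_zero' := Matrix.kronecker_zero _
  map_add' A B := Matrix.kronecker_add _ _ _
  commutes' r := by
    rw [Algebra.algebraMap_eq_smul_one, Algebra.algebraMap_eq_smul_one, Matrix.kronecker_smul,
      Matrix.one_kronecker_one]
  map_star' A := by
    rw [Matrix.star_eq_conjTranspose, Matrix.star_eq_conjTranspose, Matrix.conjTranspose_kronecker,
      Matrix.conjTranspose_one]

lemma mfun_one_kronecker (g : ℝ → ℝ) {T : Matrix β β ℂ} (h : T.IsHermitian) :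
    mfun g ((1 : Matrix α α ℂ) ⊗ₖ T) = (1 : Matrix α α ℂ) ⊗ₖ mfun g T := by
  have h' : ((1 : Matrix α α ℂ) ⊗ₖ T).IsHermitian := by
    rw [Matrix.IsHermitian, Matrix.conjTranspose_kronecker, h.eq, Matrix.conjTranspose_one]
  have hc : Continuous (oneKronecker α β) :=
    LinearMap.continuous_of_finiteDimensional (oneKronecker α β).toAlgHom.toLinearMap
  rw [mfun_eq_cfc g h, mfun_eq_cfc g h']
  exact ((oneKronecker α β).map_cfc g T (continuousOn_spectrum_matrix g T) hc h h').symm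

lemma eq_conj_eigs {M : Matrix α α ℂ} (h : M.IsHermitian) :
    M = (h.eigenvectorUnitary : Matrix α α ℂ) * Matrix.diagonal (fun i => (eigs M i : ℂ)) *
      star (h.eigenvectorUnitary : Matrix α α ℂ) := by
  simp only [eigs, dif_pos h]
  conv_lhs => rw [h.spectral_theorem, Unitary.conjStarAlgAut_apply]
  rfl

/-- The squared moduli of a row of a unitary matrix sum to one. -/
lemma sum_normSq_row {U : Matrix α α ℂ} (h : U ∈ Matrix.unitaryGroup α ℂ) (i : α) :
    ∑ j, Complex.normSq (U i j) = 1 := by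
  have := congrFun (congrFun (Matrix.mem_unitaryGroup_iff.1 h) i) i
  simp only [Matrix.mul_apply, Matrix.star_apply, Matrix.one_apply_eq, RCLike.star_def,
    Complex.mul_conj] at this
  exact_mod_cast this

lemma sum_normSq_col {U : Matrix α α ℂ} (h : U ∈ Matrix.unitaryGroup α ℂ) (j : α) :
    ∑ i, Complex.normSq (U i j) = 1 := by
  have := sum_normSq_row (Unitary.star_mem h) j
  simpa [Matrix.star_apply] using this

/-- The trace of a product of two diagonalised matrices in terms of the overlaps of the bases. -/
lemma trace_conj_diagonal_mul (U V : Matrix α α ℂ) (t s : α → ℝ) :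
    (U * Matrix.diagonal (fun i => (t i : ℂ)) * star U *
      (V * Matrix.diagonal (fun i => (s i : ℂ)) * star V)).trace =
      ((∑ i, ∑ j, t i * s j * Complex.normSq ((star U * V) i j) : ℝ) : ℂ) := by
  have : (U * Matrix.diagonal (fun i => (t i : ℂ)) * star U *
      (V * Matrix.diagonal (fun i => (s i : ℂ)) * star V)).trace =
      (Matrix.diagonal (fun i => (t i : ℂ)) * (star U * V) *
        Matrix.diagonal (fun i => (s i : ℂ)) * star (star U * V)).trace := by
    rw [star_mul, star_star, mul_assoc U, mul_assoc U, Matrix.trace_mul_comm]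
    simp only [mul_assoc]
  rw [this]
  generalize star U * V = W
  simp only [Matrix.trace, Matrix.diag]
  push_cast
  refine Finset.sum_congr rfl fun i _ => ?_
  rw [Matrix.mul_apply]
  refine Finset.sum_congr rfl fun j _ => ?_
  rw [Matrix.mul_diagonal, Matrix.diagonal_mul, Matrix.star_apply, RCLike.star_def,
    Complex.normSq_eq_conj_mul_self]
  ring

/-- Hölder duality, upper bound: `Tr[τ^p σ] ≤ ‖σ‖_q` for states `τ`, with `q = 1/(1-p)`. -/
lemma trace_mpow_mul_le_schatten {p : ℝ} (hp : 0 < p) (hp1 : p < 1) {τ σ : Matrix α α ℂ}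
    (hτ : IsState τ) (hσ : σ.PosSemidef) :
    (mpow p τ * σ).trace.re ≤ schatten (1 / (1 - p)) σ := by
  have hU := hτ.1.isHermitian.eigenvectorUnitary.2
  have hV := hσ.isHermitian.eigenvectorUnitary.2
  have hW := mul_mem (Unitary.star_mem hU) hV
  have e : mpow p τ = (hτ.1.isHermitian.eigenvectorUnitary : Matrix α α ℂ) *
      Matrix.diagonal (fun i => ((eigs τ i ^ p : ℝ) : ℂ)) *
      star (hτ.1.isHermitian.eigenvectorUnitary : Matrix α α ℂ) := by
    simp only [mpow, mfun, eigs, dif_pos hτ.1.isHermitian]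
  rw [e]
  conv_lhs => rw [eq_conj_eigs hσ.isHermitian]
  rw [trace_conj_diagonal_mul, Complex.ofReal_re]
  refine (sum_rpow_mul_le_of_stochastic hp hp1 (eigs_nonneg hτ.1) (eigs_nonneg hσ)
    (fun _ _ => Complex.normSq_nonneg _) (sum_normSq_row hW) (sum_normSq_col hW)).trans_eq ?_
  rw [sum_eigs_eq_one hτ, Real.one_rpow, one_mul, schatten, one_div_one_div]

/-- Hölder duality, attainment: some state `τ` has `Tr[τ^p σ] = ‖σ‖_q`, with `q = 1/(1-p)`. -/
lemma exists_trace_mpow_mul_eq_schatten [Nonempty α] {p : ℝ} (hp : 0 < p) (hp1 : p < 1)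
    {σ : Matrix α α ℂ} (hσ : σ.PosSemidef) :
    ∃ τ : Matrix α α ℂ, IsState τ ∧ (mpow p τ * σ).trace.re = schatten (1 / (1 - p)) σ := by
  have h1p : 0 < 1 - p := by linarith
  have hH := hσ.isHermitian
  set q := 1 / (1 - p) with hq
  have hq0 : 0 < q := by positivity
  have hqp : q * p + 1 = q := by rw [hq]; field_simp; ring
  set S := ∑ i, eigs σ i ^ q with hS
  have hnn : ∀ i, 0 ≤ eigs σ i ^ q := fun i => Real.rpow_nonneg (eigs_nonneg hσ i) _
  have hS0 : 0 ≤ S := Finset.sum_nonneg fun i _ => hnn i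
  rcases hS0.eq_or_lt with h0 | hpos
  · have hz : ∀ i, eigs σ i = 0 := fun i => by
      have := (Finset.sum_eq_zero_iff_of_nonneg fun i _ => hnn i).1 h0.symm i (Finset.mem_univ i)
      exact (Real.rpow_eq_zero (eigs_nonneg hσ i) hq0.ne').1 this
    have hσ0 : σ = 0 := by
      rw [eq_conj_eigs hH]
      simp [hz]
    obtain ⟨i₀⟩ := ‹Nonempty α›
    refine ⟨proj (Pi.single i₀ 1), isState_proj ?_, ?_⟩
    · rw [UnitVector, Finset.sum_eq_single i₀] <;> simp +contextual
    · rw [schatten, ← hS, ← h0, Real.zero_rpow (one_div_pos.2 hq0).ne', hσ0]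
      simp
  · have hc := fun g => continuousOn_spectrum_matrix g σ
    have hτ : (cfc (fun x => x ^ q / S) σ).IsHermitian := cfc_predicate _ σ
    refine ⟨cfc (fun x => x ^ q / S) σ, ⟨?_, ?_⟩, ?_⟩
    · refine hτ.posSemidef_iff_eigenvalues_nonneg.2 fun i => ?_
      have hi := hτ.eigenvalues_mem_spectrum_real i
      rw [cfc_map_spectrum _ _ hH.isSelfAdjoint (hc _)] at hi
      obtain ⟨x, hx, hxi⟩ := hi
      exact hxi ▸ div_nonneg (Real.rpow_nonneg (nonneg_of_mem_spectrum hσ hx) _) hS0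
    · rw [← mfun_eq_cfc _ hH, trace_mfun _ hH, ← Finset.sum_div, ← hS, div_self hpos.ne',
        Complex.ofReal_one]
    · have e : mpow p (cfc (fun x => x ^ q / S) σ) * σ =
          mfun (fun x => (x ^ q / S) ^ p * x) σ := by
        rw [mpow, mfun_eq_cfc _ hτ, mfun_eq_cfc _ hH, cfc_mul _ _ _ (hc _) (hc _),
          cfc_id' ℝ σ hH.isSelfAdjoint,
          cfc_comp' (fun x => x ^ p) (fun x => x ^ q / S) σ
            ((Matrix.finite_real_spectrum.image _).continuousOn _) (hc _) hH.isSelfAdjoint]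
      rw [e, trace_mfun _ hH, Complex.ofReal_re, schatten, ← hS]
      have e2 : ∀ i, (eigs σ i ^ q / S) ^ p * eigs σ i = eigs σ i ^ q / S ^ p := fun i => by
        have hi := eigs_nonneg hσ i
        rw [Real.div_rpow (hnn i) hS0, ← Real.rpow_mul hi, div_mul_eq_mul_div]
        congr 1
        nth_rewrite 2 [← Real.rpow_one (eigs σ i)]
        rw [← Real.rpow_add_of_nonneg hi (by positivity) zero_le_one, hqp]
      rw [Finset.sum_congr rfl fun i _ => e2 i, ← Finset.sum_div, ← hS, hq, one_div_one_div,
        Real.rpow_sub hpos, Real.rpow_one]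

/-- Expectation values in unit vectors are bounded by the largest eigenvalue. -/
lemma trace_proj_mul_le_lmax {G : Matrix α α ℂ} (hG : G.IsHermitian) {φ : α → ℂ}
    (hφ : UnitVector φ) : (proj φ * G).trace.re ≤ lmax G := by
  have hP := (posSemidef_proj φ).isHermitian
  have hW := mul_mem (Unitary.star_mem hP.eigenvectorUnitary.2) hG.eigenvectorUnitary.2
  conv_lhs => rw [eq_conj_eigs hP, eq_conj_eigs hG]
  rw [trace_conj_diagonal_mul, Complex.ofReal_re]
  calc _ ≤ ∑ i, ∑ j, eigs (proj φ) i * lmax G * Complex.normSq _ := by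
        refine Finset.sum_le_sum fun i _ => Finset.sum_le_sum fun j _ => ?_
        refine mul_le_mul_of_nonneg_right (mul_le_mul_of_nonneg_left ?_ ?_)
          (Complex.normSq_nonneg _)
        · exact le_ciSup (Set.finite_range (eigs G)).bddAbove j
        · exact eigs_nonneg (posSemidef_proj φ) i
    _ = lmax G := by
        simp only [← Finset.mul_sum, sum_normSq_row hW, mul_one, ← Finset.sum_mul,
          sum_eigs_eq_one (isState_proj hφ), one_mul]

/-- The largest eigenvalue is an expectation value in some unit vector. -/
lemma exists_trace_proj_mul_eq_lmax [Nonempty α] {G : Matrix α α ℂ} (hG : G.IsHermitian) :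
    ∃ φ : α → ℂ, UnitVector φ ∧ (proj φ * G).trace.re = lmax G := by
  obtain ⟨i, hi⟩ := exists_eq_ciSup_of_finite (f := eigs G)
  have hu : UnitVector (⇑(hG.eigenvectorBasis i)) := by
    have := sum_normSq_col hG.eigenvectorUnitary.2 i
    simpa only [UnitVector, Matrix.IsHermitian.eigenvectorUnitary_apply] using this
  refine ⟨_, hu, ?_⟩
  rw [Matrix.trace_mul_comm, proj, Matrix.mul_vecMulVec, hG.mulVec_eigenvectorBasis,
    Matrix.smul_vecMulVec, Matrix.trace_smul, ← proj, trace_proj hu, lmax, ← hi, eigs, dif_pos hG]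
  simp

end

/-- For 0 ≤ M ≤ I on H_A ⊗ H_B and 0 < p < 1,
h_p(M) = max over states τ on H_B of ‖M^{p/2} (I_A ⊗ τ)^p M^{p/2}‖ (operator norm =
largest eigenvalue, the operators being positive semidefinite) equals
max over unit φ of ‖Tr_A[M^{p/2} |φ⟩⟨φ| M^{p/2}]‖_q with q = 1/(1-p). -/
theorem hp_eq_max_output_purity {a b : ℕ} (ha : 0 < a) (hb : 0 < b)
    (M : Matrix (Fin a × Fin b) (Fin a × Fin b) ℂ)
    (hM : M.PosSemidef) (hM1 : ((1 : Matrix (Fin a × Fin b) (Fin a × Fin b) ℂ) - M).PosSemidef)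
    (p : ℝ) (hp : 0 < p) (hp1 : p < 1) :
    sSup {x | ∃ τ : Matrix (Fin b) (Fin b) ℂ, IsState τ ∧
        x = lmax (mpow (p/2) M * mpow p ((1 : Matrix (Fin a) (Fin a) ℂ) ⊗ₖ τ) * mpow (p/2) M)}
      = sSup {x | ∃ φ : Fin a × Fin b → ℂ, UnitVector φ ∧
        x = schatten (1/(1-p)) (trA (mpow (p/2) M * proj φ * mpow (p/2) M))} := by
  have : Nonempty (Fin a) := ⟨⟨0, ha⟩⟩
  have : Nonempty (Fin b) := ⟨⟨0, hb⟩⟩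
  set K := mpow (p / 2) M
  have hK : K.IsHermitian := isHermitian_mfun _ hM.isHermitian
  have hG : ∀ τ : Matrix (Fin b) (Fin b) ℂ, IsState τ →
      (K * mpow p ((1 : Matrix (Fin a) (Fin a) ℂ) ⊗ₖ τ) * K).IsHermitian := fun τ hτ => by
    have hN : ((1 : Matrix (Fin a) (Fin a) ℂ) ⊗ₖ τ).IsHermitian := by
      rw [Matrix.IsHermitian, Matrix.conjTranspose_kronecker, hτ.1.isHermitian.eq,
        Matrix.conjTranspose_one]
    have := Matrix.isHermitian_mul_mul_conjTranspose K (isHermitian_mfun (fun x => x ^ p) hN)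
    rwa [hK.eq] at this
  have hσ : ∀ φ : Fin a × Fin b → ℂ, (trA (K * proj φ * K)).PosSemidef := fun φ => by
    have := (posSemidef_proj φ).mul_mul_conjTranspose_same K
    rw [hK.eq] at this
    exact posSemidef_trA this
  have hswap : ∀ (τ : Matrix (Fin b) (Fin b) ℂ) (φ : Fin a × Fin b → ℂ), IsState τ →
      (proj φ * (K * mpow p ((1 : Matrix (Fin a) (Fin a) ℂ) ⊗ₖ τ) * K)).trace =
        (mpow p τ * trA (K * proj φ * K)).trace := fun τ φ hτ => by
    rw [← trace_one_kronecker_mul, mpow, mfun_one_kronecker _ hτ.1.isHermitian, ← mpow, ← mul_assoc,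
      Matrix.trace_mul_comm, ← mul_assoc, ← mul_assoc, Matrix.trace_mul_comm]
  refine csSup_eq_csSup_of_forall_exists_le ?_ ?_
  · rintro _ ⟨τ, hτ, rfl⟩
    obtain ⟨φ, hφ, h⟩ := exists_trace_proj_mul_eq_lmax (hG τ hτ)
    refine ⟨_, ⟨φ, hφ, rfl⟩, ?_⟩
    rw [← h, hswap τ φ hτ]
    exact trace_mpow_mul_le_schatten hp hp1 hτ (hσ φ)
  · rintro _ ⟨φ, hφ, rfl⟩
    obtain ⟨τ, hτ, h⟩ := exists_trace_mpow_mul_eq_schatten hp hp1 (hσ φ)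
    refine ⟨_, ⟨τ, hτ, rfl⟩, ?_⟩
    rw [← h, ← hswap τ φ hτ]
    exact trace_proj_mul_le_lmax (hG τ hτ) hφ
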